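/- arXiv:1410.6491 — 5 statements merged into one kernel-verified Lean document; each statement's English description precedes it below -/
import Mathlib

section
/- (Lemma 2.1 for the GOY model) For any real numbers α₁, α₂, α₃ with α₁ + α₂ + α₃ ≥ 1/2 there exists a constant c > 0, depending only on α₁, α₂, α₃, a, b, k₀ and λ, such that for every u ∈ V_{α₁} and v ∈ V_{α₂} the sequence B(u,v) belongs to V_{−α₃} and Σ_{n=1}^∞ k_n^{−4α₃} |b_n(u,v)|² ≤ c² (Σ_{n=1}^∞ k_n^{4α₁}|u_n|²) (Σ_{n=1}^∞ k_n^{4α₂}|v_n|²); that is, ‖B(u,v)‖_{V_{−α₃}} ≤ c ‖u‖_{V_{α₁}} ‖v‖_{V_{α₂}}. -/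
open scoped ComplexConjugate

/-- The wavenumbers `k_n = k₀ λ^n`. -/
noncomputable def kk (k0 lam : ℝ) (n : ℕ) : ℝ := k0 * lam ^ n

/-- Extension of a sequence (meaningful for indices `n ≥ 1`) by zero at index `0`,
realizing the convention `u₀ = u₋₁ = 0` (natural subtraction sends `-1` to `0`). -/
def sh (u : ℕ → ℂ) (n : ℕ) : ℂ := if n = 0 then 0 else u n

/-- The GOY shell-model nonlinearity `b_n(u,v)`, for `n ≥ 1`. -/
noncomputable def bGOY (a b k0 lam : ℝ) (u v : ℕ → ℂ) (n : ℕ) : ℂ :=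
  Complex.I * ((a : ℂ) * (kk k0 lam (n+1) : ℝ) * conj (sh u (n+1)) * conj (sh v (n+2))
    + (b : ℂ) * (kk k0 lam n : ℝ) * conj (sh u (n-1)) * conj (sh v (n+1))
    - (a : ℂ) * (kk k0 lam (n-1) : ℝ) * conj (sh u (n-1)) * conj (sh v (n-2))
    - (b : ℂ) * (kk k0 lam (n-1) : ℝ) * conj (sh u (n-2)) * conj (sh v (n-1)))

/-- `B(u,v) = -(b₁(u,v), b₂(u,v), …)` for the GOY model. -/
noncomputable def BGOY (a b k0 lam : ℝ) (u v : ℕ → ℂ) (n : ℕ) : ℂ := - bGOY a b k0 lam u v n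

lemma rpow_le_rpow_abs_mul_rpow {K p L : ℝ} (hK : 0 < K) (hp : 0 < p) (hL : 1 ≤ L)
    (h1 : K ≤ p * L) (h2 : p ≤ K * L) (x : ℝ) : K ^ x ≤ L ^ |x| * p ^ x := by
  have hL0 : 0 < L := by linarith
  rcases le_total 0 x with hx | hx
  · rw [abs_of_nonneg hx, ← Real.mul_rpow hL0.le hp.le, mul_comm L p]
    exact Real.rpow_le_rpow hK.le h1 hx
  · have h := Real.rpow_le_rpow_of_nonpos hp h2 hx
    rw [Real.mul_rpow hK.le hL0.le] at h
    calc K ^ x = L ^ (-x) * (K ^ x * L ^ x) := by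
          rw [mul_left_comm, ← Real.rpow_add hL0]; simp
      _ ≤ L ^ |x| * p ^ x := by
          rw [abs_of_nonpos hx]; gcongr

lemma kk_pos {k0 lam : ℝ} (hk0 : 0 < k0) (hlam : 1 < lam) (n : ℕ) : 0 < kk k0 lam n := by
  unfold kk; positivity

lemma le_kk {k0 lam : ℝ} (hk0 : 0 < k0) (hlam : 1 < lam) (n : ℕ) : k0 ≤ kk k0 lam n :=
  le_mul_of_one_le_right hk0.le (one_le_pow₀ hlam.le)

lemma kk_le_kk_mul_sq {k0 lam : ℝ} (hk0 : 0 < k0) (hlam : 1 < lam) {m n : ℕ} (h : m ≤ n + 2) :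
    kk k0 lam m ≤ kk k0 lam n * lam ^ 2 := by
  unfold kk
  rw [mul_assoc, ← pow_add]
  exact mul_le_mul_of_nonneg_left (pow_le_pow_right₀ hlam.le h) hk0.le

/-- The constant comparing the weights of a single GOY interaction. -/
noncomputable def weightConst (k0 lam α₁ α₂ α₃ : ℝ) : ℝ :=
  (lam ^ 2) ^ 2 * k0 ^ (2 - 4 * (α₁ + α₂ + α₃)) * (lam ^ 2) ^ |4 * α₁| * (lam ^ 2) ^ |4 * α₂|

lemma weight_le {k0 lam : ℝ} (hk0 : 0 < k0) (hlam : 1 < lam) {α₁ α₂ α₃ : ℝ}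
    (hα : (1 : ℝ) / 2 ≤ α₁ + α₂ + α₃) {N r p q : ℕ} (hr : r ≤ N + 2)
    (hp : N ≤ p + 2) (hp' : p ≤ N + 2) (hq : N ≤ q + 2) (hq' : q ≤ N + 2) :
    kk k0 lam N ^ (4 * (-α₃)) * kk k0 lam r ^ 2 ≤
      weightConst k0 lam α₁ α₂ α₃ * (kk k0 lam p ^ (4 * α₁) * kk k0 lam q ^ (4 * α₂)) := by
  have hL : 1 ≤ lam ^ 2 := one_le_pow₀ hlam.le
  have hK := kk_pos hk0 hlam N
  have hP := kk_pos hk0 hlam p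
  have hQ := kk_pos hk0 hlam q
  have hR := kk_pos hk0 hlam r
  have e1 := rpow_le_rpow_abs_mul_rpow hK hP hL (kk_le_kk_mul_sq hk0 hlam hp)
    (kk_le_kk_mul_sq hk0 hlam hp') (4 * α₁)
  have e2 := rpow_le_rpow_abs_mul_rpow hK hQ hL (kk_le_kk_mul_sq hk0 hlam hq)
    (kk_le_kk_mul_sq hk0 hlam hq') (4 * α₂)
  have e3 := kk_le_kk_mul_sq hk0 hlam hr
  have e4 : kk k0 lam N ^ (2 - 4 * (α₁ + α₂ + α₃)) ≤ k0 ^ (2 - 4 * (α₁ + α₂ + α₃)) :=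
    Real.rpow_le_rpow_of_nonpos hk0 (le_kk hk0 hlam N) (by linarith)
  have e5 : kk k0 lam N ^ (4 * (-α₃)) * kk k0 lam N ^ 2 =
      kk k0 lam N ^ (2 - 4 * (α₁ + α₂ + α₃)) * kk k0 lam N ^ (4 * α₁)
        * kk k0 lam N ^ (4 * α₂) := by
    rw [← Real.rpow_natCast, ← Real.rpow_add hK, ← Real.rpow_add hK, ← Real.rpow_add hK]
    congr 1
    push_cast
    ring
  calc kk k0 lam N ^ (4 * (-α₃)) * kk k0 lam r ^ 2
      ≤ kk k0 lam N ^ (4 * (-α₃)) * (kk k0 lam N * lam ^ 2) ^ 2 := by gcongr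
    _ = (lam ^ 2) ^ 2 * (kk k0 lam N ^ (2 - 4 * (α₁ + α₂ + α₃)) * kk k0 lam N ^ (4 * α₁)
        * kk k0 lam N ^ (4 * α₂)) := by rw [← e5]; ring
    _ ≤ (lam ^ 2) ^ 2 * (k0 ^ (2 - 4 * (α₁ + α₂ + α₃))
        * ((lam ^ 2) ^ |4 * α₁| * kk k0 lam p ^ (4 * α₁))
        * ((lam ^ 2) ^ |4 * α₂| * kk k0 lam q ^ (4 * α₂))) := by gcongr
    _ = _ := by unfold weightConst; ring

lemma weight_mul_norm_sq_le {k0 lam : ℝ} (hk0 : 0 < k0) (hlam : 1 < lam) {α₁ α₂ α₃ : ℝ}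
    (hα : (1 : ℝ) / 2 ≤ α₁ + α₂ + α₃) (s : ℝ) (x y : ℂ) {N r p q : ℕ} (hr : r ≤ N + 2)
    (hp : N ≤ p + 2) (hp' : p ≤ N + 2) (hq : N ≤ q + 2) (hq' : q ≤ N + 2) :
    kk k0 lam N ^ (4 * (-α₃)) * ‖(s : ℂ) * (kk k0 lam r : ℝ) * conj x * conj y‖ ^ 2 ≤
      s ^ 2 * weightConst k0 lam α₁ α₂ α₃ *
        ((kk k0 lam p ^ (4 * α₁) * ‖x‖ ^ 2) * (kk k0 lam q ^ (4 * α₂) * ‖y‖ ^ 2)) := by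
  have h := mul_le_mul_of_nonneg_left (weight_le hk0 hlam hα hr hp hp' hq hq')
    (by positivity : 0 ≤ s ^ 2 * ‖x‖ ^ 2 * ‖y‖ ^ 2)
  simp only [norm_mul, Complex.norm_real, RCLike.norm_conj, mul_pow, Real.norm_eq_abs, sq_abs]
  linarith

lemma norm_sq_add_add_sub_sub_le (x y z w : ℂ) :
    ‖x + y - z - w‖ ^ 2 ≤ 4 * (‖x‖ ^ 2 + ‖y‖ ^ 2 + ‖z‖ ^ 2 + ‖w‖ ^ 2) := by
  have h : ‖x + y - z - w‖ ≤ ‖x‖ + ‖y‖ + ‖z‖ + ‖w‖ :=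
    (norm_sub_le _ _).trans (add_le_add_left ((norm_sub_le _ _).trans
      (add_le_add_left (norm_add_le _ _) _)) _)
  have h2 := pow_le_pow_left₀ (norm_nonneg _) h 2
  nlinarith [sq_nonneg (‖x‖ - ‖y‖), sq_nonneg (‖x‖ - ‖z‖), sq_nonneg (‖x‖ - ‖w‖),
    sq_nonneg (‖y‖ - ‖z‖), sq_nonneg (‖y‖ - ‖w‖), sq_nonneg (‖z‖ - ‖w‖)]

/-- The weighted squared modulus of the `n`-th mode, zero for `n = 0`. -/
noncomputable def modeEnergy (k0 lam α : ℝ) (u : ℕ → ℂ) (n : ℕ) : ℝ :=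
  kk k0 lam n ^ (4 * α) * ‖sh u n‖ ^ 2

lemma modeEnergy_nonneg {k0 lam : ℝ} (hk0 : 0 < k0) (hlam : 1 < lam) (α : ℝ) (u : ℕ → ℂ)
    (n : ℕ) : 0 ≤ modeEnergy k0 lam α u n := by
  have := kk_pos hk0 hlam n
  unfold modeEnergy
  positivity

lemma hasSum_modeEnergy {k0 lam α : ℝ} {u : ℕ → ℂ}
    (h : Summable fun n : ℕ => kk k0 lam (n + 1) ^ (4 * α) * ‖u (n + 1)‖ ^ 2) :
    HasSum (modeEnergy k0 lam α u)
      (∑' n : ℕ, kk k0 lam (n + 1) ^ (4 * α) * ‖u (n + 1)‖ ^ 2) := by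
  rw [← hasSum_nat_add_iff' 1]
  simpa [modeEnergy, sh] using h.hasSum

lemma weight_mul_norm_BGOY_sq_le {k0 lam : ℝ} (a b : ℝ) (hk0 : 0 < k0) (hlam : 1 < lam)
    {α₁ α₂ α₃ : ℝ} (hα : (1 : ℝ) / 2 ≤ α₁ + α₂ + α₃) (u v : ℕ → ℂ) (n : ℕ) :
    kk k0 lam (n + 1) ^ (4 * (-α₃)) * ‖BGOY a b k0 lam u v (n + 1)‖ ^ 2 ≤
      4 * weightConst k0 lam α₁ α₂ α₃ *
        (a ^ 2 * (modeEnergy k0 lam α₁ u (n + 2) * modeEnergy k0 lam α₂ v (n + 3))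
        + b ^ 2 * (modeEnergy k0 lam α₁ u n * modeEnergy k0 lam α₂ v (n + 2))
        + a ^ 2 * (modeEnergy k0 lam α₁ u n * modeEnergy k0 lam α₂ v (n - 1))
        + b ^ 2 * (modeEnergy k0 lam α₁ u (n - 1) * modeEnergy k0 lam α₂ v n)) := by
  have hW : 0 ≤ kk k0 lam (n + 1) ^ (4 * (-α₃)) := (Real.rpow_pos_of_pos (kk_pos hk0 hlam _) _).le
  have t1 := weight_mul_norm_sq_le hk0 hlam hα a (sh u (n + 2)) (sh v (n + 3)) (N := n + 1)
    (r := n + 2) (p := n + 2) (q := n + 3) (by omega) (by omega) (by omega) (by omega) (by omega)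
  have t2 := weight_mul_norm_sq_le hk0 hlam hα b (sh u n) (sh v (n + 2)) (N := n + 1)
    (r := n + 1) (p := n) (q := n + 2) (by omega) (by omega) (by omega) (by omega) (by omega)
  have t3 := weight_mul_norm_sq_le hk0 hlam hα a (sh u n) (sh v (n - 1)) (N := n + 1)
    (r := n) (p := n) (q := n - 1) (by omega) (by omega) (by omega) (by omega) (by omega)
  have t4 := weight_mul_norm_sq_le hk0 hlam hα b (sh u (n - 1)) (sh v n) (N := n + 1)
    (r := n) (p := n - 1) (q := n) (by omega) (by omega) (by omega) (by omega) (by omega)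
  rw [BGOY, bGOY, norm_neg, norm_mul, Complex.norm_I, one_mul]
  refine (mul_le_mul_of_nonneg_left (norm_sq_add_add_sub_sub_le _ _ _ _) hW).trans ?_
  simp only [Nat.add_sub_cancel, show n + 1 - 2 = n - 1 by omega, add_assoc, Nat.reduceAdd]
  simp only [modeEnergy]
  linarith

/-- Lemma 2.1 for the GOY model: `B : V_{α₁} × V_{α₂} → V_{-α₃}` is bounded whenever
`α₁ + α₂ + α₃ ≥ 1/2`. -/
theorem stmt0 (k0 lam a b : ℝ) (hk0 : 0 < k0) (hlam : 1 < lam)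
    (α₁ α₂ α₃ : ℝ) (hα : (1:ℝ)/2 ≤ α₁ + α₂ + α₃) :
    ∃ c : ℝ, 0 < c ∧ ∀ u v : ℕ → ℂ,
      Summable (fun n : ℕ => (kk k0 lam (n+1)) ^ (4*α₁) * ‖u (n+1)‖^2) →
      Summable (fun n : ℕ => (kk k0 lam (n+1)) ^ (4*α₂) * ‖v (n+1)‖^2) →
      Summable (fun n : ℕ =>
          (kk k0 lam (n+1)) ^ (4*(-α₃)) * ‖BGOY a b k0 lam u v (n+1)‖^2) ∧
      (∑' n : ℕ, (kk k0 lam (n+1)) ^ (4*(-α₃)) * ‖BGOY a b k0 lam u v (n+1)‖^2)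
        ≤ c^2 * (∑' n : ℕ, (kk k0 lam (n+1)) ^ (4*α₁) * ‖u (n+1)‖^2)
             * (∑' n : ℕ, (kk k0 lam (n+1)) ^ (4*α₂) * ‖v (n+1)‖^2) := by
  have hC : 0 ≤ weightConst k0 lam α₁ α₂ α₃ := by unfold weightConst; positivity
  set C := weightConst k0 lam α₁ α₂ α₃ with hCdef
  refine ⟨√(8 * C * (a ^ 2 + b ^ 2) + 1), by positivity, fun u v hu hv => ?_⟩
  rw [Real.sq_sqrt (by positivity)]
  have hX := hasSum_modeEnergy hu
  have hY := hasSum_modeEnergy hv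
  set S := ∑' n : ℕ, kk k0 lam (n + 1) ^ (4 * α₁) * ‖u (n + 1)‖ ^ 2
  set T := ∑' n : ℕ, kk k0 lam (n + 1) ^ (4 * α₂) * ‖v (n + 1)‖ ^ 2
  have hX0 := modeEnergy_nonneg hk0 hlam α₁ u
  have hY0 := modeEnergy_nonneg hk0 hlam α₂ v
  have hXS : ∀ n, modeEnergy k0 lam α₁ u n ≤ S := fun n => le_hasSum hX n fun j _ => hX0 j
  have hYT : ∀ n, modeEnergy k0 lam α₂ v n ≤ T := fun n => le_hasSum hY n fun j _ => hY0 j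
  have hS : 0 ≤ S := hX.nonneg hX0
  have hT : 0 ≤ T := hY.nonneg hY0
  have hX2 := (hasSum_nat_add_iff' 2).2 hX
  have hsum := ((((hX2.mul_right T).mul_left (a ^ 2)).add
    ((hX.mul_right T).mul_left (b ^ 2))).add ((hX.mul_right T).mul_left (a ^ 2))).add
    ((hY.mul_left S).mul_left (b ^ 2)) |>.mul_left (4 * C)
  have hle := fun n => (weight_mul_norm_BGOY_sq_le a b hk0 hlam hα u v n).trans (by
    rw [← hCdef]
    gcongr
    exacts [hX0 _, hYT _, hX0 _, hYT _, hX0 _, hYT _, hY0 _, hXS _] :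
      _ ≤ 4 * C * (a ^ 2 * (modeEnergy k0 lam α₁ u (n + 2) * T)
        + b ^ 2 * (modeEnergy k0 lam α₁ u n * T) + a ^ 2 * (modeEnergy k0 lam α₁ u n * T)
        + b ^ 2 * (S * modeEnergy k0 lam α₂ v n)))
  have hsm := Summable.of_nonneg_of_le (fun n => mul_nonneg
    (Real.rpow_nonneg (kk_pos hk0 hlam (n + 1)).le _) (sq_nonneg _)) hle hsum.summable
  refine ⟨hsm, (hasSum_le hle hsm.hasSum hsum).trans ?_⟩
  have hP : 0 ≤ ∑ i ∈ Finset.range 2, modeEnergy k0 lam α₁ u i :=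
    Finset.sum_nonneg fun i _ => hX0 i
  have h1 : 0 ≤ 4 * C * (a ^ 2 * ((∑ i ∈ Finset.range 2, modeEnergy k0 lam α₁ u i) * T)) := by
    positivity
  have h2 : 0 ≤ S * T := mul_nonneg hS hT
  linarith
end

section
/- (Energy conservation identity, SABRA model) For every u ∈ V and v ∈ V_{1/2}, the series Σ_{n=1}^∞ B(u,v)_n conj(v_n) converges absolutely and its real part vanishes: Re (B(u,v), v)_V = Re Σ_{n=1}^∞ B(u,v)_n conj(v_n) = 0. -/
open scoped ComplexConjugate

/-- The SABRA shell-model nonlinearity `b_n(u,v)`, for `n ≥ 1`. -/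
noncomputable def bSAB (a b k0 lam : ℝ) (u v : ℕ → ℂ) (n : ℕ) : ℂ :=
  - Complex.I * ((a : ℂ) * (kk k0 lam (n+1) : ℝ) * conj (sh u (n+1)) * sh v (n+2)
    + (b : ℂ) * (kk k0 lam n : ℝ) * conj (sh u (n-1)) * sh v (n+1)
    + (a : ℂ) * (kk k0 lam (n-1) : ℝ) * sh u (n-1) * sh v (n-2)
    + (b : ℂ) * (kk k0 lam (n-1) : ℝ) * sh u (n-2) * sh v (n-1))

/-- `B(u,v) = -(b₁(u,v), b₂(u,v), …)` for the SABRA model. -/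
noncomputable def BSAB (a b k0 lam : ℝ) (u v : ℕ → ℂ) (n : ℕ) : ℂ := - bSAB a b k0 lam u v n

lemma summable_mul_shift_of_sq {w : ℕ → ℝ} (hw : Summable fun n => w n ^ 2)
    (h0 : ∀ n, 0 ≤ w n) (k : ℕ) : Summable fun n => w (n + k) * w n := by
  refine Summable.of_nonneg_of_le (fun n => mul_nonneg (h0 _) (h0 _)) (fun n => ?_)
    (((summable_nat_add_iff k).2 hw).add hw)
  nlinarith [sq_nonneg (w (n + k) - w n), sq_nonneg (w (n + k)), sq_nonneg (w n)]

lemma exists_norm_le_of_summable_sq {u : ℕ → ℂ} (hu : Summable fun n => ‖u n‖ ^ 2) :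
    ∃ M : ℝ, 0 ≤ M ∧ ∀ n, ‖u n‖ ≤ M :=
  ⟨√(∑' n, ‖u n‖ ^ 2), Real.sqrt_nonneg _, fun n =>
    Real.le_sqrt_of_sq_le (hu.le_tsum n fun _ _ => sq_nonneg _)⟩

/-- A trilinear term is summable when it couples a bounded sequence, a weighted
square-summable sequence, and an unweighted copy of the latter. -/
lemma summable_norm_trilinear {k0 lam M : ℝ} (hk0 : 0 < k0) (hlam : 1 < lam) (c : ℂ)
    {p v : ℕ → ℂ} {r : ℕ → ℝ} (m : ℕ) (hM : 0 ≤ M) (hp : ∀ n, ‖p n‖ ≤ M)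
    (hr : ∀ n, |r n| ≤ kk k0 lam (n + m + 1))
    (hv : Summable fun n : ℕ => (kk k0 lam (n + 1)) ^ 2 * ‖v (n + 1)‖ ^ 2) :
    Summable fun n => ‖c * (r n : ℂ) * p n * v (n + m + 1) * conj (v (n + 1))‖ := by
  have hkk : ∀ n, k0 ≤ kk k0 lam n := fun n =>
    le_mul_of_one_le_right hk0.le (one_le_pow₀ hlam.le)
  have hw : Summable fun n => (kk k0 lam (n + m + 1) * ‖v (n + m + 1)‖) *
      (kk k0 lam (n + 1) * ‖v (n + 1)‖) :=
    summable_mul_shift_of_sq (w := fun n => kk k0 lam (n + 1) * ‖v (n + 1)‖)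
      (by simpa only [mul_pow] using hv)
      (fun n => mul_nonneg (hk0.le.trans (hkk _)) (norm_nonneg _)) m
  refine Summable.of_nonneg_of_le (fun _ => norm_nonneg _) (fun n => ?_)
    (hw.mul_left (‖c‖ * M / k0))
  have hv' : ‖v (n + 1)‖ ≤ kk k0 lam (n + 1) * ‖v (n + 1)‖ / k0 := by
    rw [le_div_iff₀ hk0, mul_comm]
    exact mul_le_mul_of_nonneg_right (hkk _) (norm_nonneg _)
  have hk : 0 ≤ kk k0 lam (n + m + 1) := hk0.le.trans (hkk _)
  simp only [norm_mul, RCLike.norm_conj, Complex.norm_real, Real.norm_eq_abs]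
  calc ‖c‖ * |r n| * ‖p n‖ * ‖v (n + m + 1)‖ * ‖v (n + 1)‖
      ≤ ‖c‖ * kk k0 lam (n + m + 1) * M * ‖v (n + m + 1)‖ *
          (kk k0 lam (n + 1) * ‖v (n + 1)‖ / k0) := by
        gcongr
        · exact hr n
        · exact hp n
    _ = _ := by ring

/-- If `g` is `conj ∘ f` delayed by `m` steps, both series converge absolutely together and
their sums are conjugate. -/
lemma summable_norm_and_tsum_eq_conj_of_delay {f g : ℕ → ℂ} (m : ℕ)
    (hf : Summable fun n => ‖f n‖) (h0 : ∀ n < m, g n = 0)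
    (hg : ∀ n, g (n + m) = conj (f n)) :
    (Summable fun n => ‖g n‖) ∧ ∑' n, g n = conj (∑' n, f n) := by
  have hs : Summable fun n => ‖g n‖ := by
    rw [← summable_nat_add_iff m]
    simpa only [hg, RCLike.norm_conj] using hf
  refine ⟨hs, ?_⟩
  rw [← hs.of_norm.sum_add_tsum_nat_add m, Finset.sum_eq_zero fun n hn =>
    h0 n (Finset.mem_range.1 hn), zero_add, Complex.conj_tsum]
  simp only [hg]

/-- Energy conservation identity for the SABRA model: for `u ∈ V` and `v ∈ V_{1/2}`,
the series `Σ B(u,v)_n conj(v_n)` converges absolutely and `Re (B(u,v), v)_V = 0`. -/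
theorem stmt3 (k0 lam a b : ℝ) (hk0 : 0 < k0) (hlam : 1 < lam)
    (u v : ℕ → ℂ)
    (hu : Summable (fun n : ℕ => ‖u (n+1)‖^2))
    (hv : Summable (fun n : ℕ => (kk k0 lam (n+1))^2 * ‖v (n+1)‖^2)) :
    Summable (fun n : ℕ => ‖BSAB a b k0 lam u v (n+1) * conj (v (n+1))‖) ∧
    (∑' n : ℕ, BSAB a b k0 lam u v (n+1) * conj (v (n+1))).re = 0 := by
  obtain ⟨M, hM, huM⟩ := exists_norm_le_of_summable_sq (u := fun n => u (n + 1)) hu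
  have hkk0 : ∀ n, 0 ≤ kk k0 lam n := fun n =>
    mul_nonneg hk0.le (pow_nonneg (zero_le_one.trans hlam.le) n)
  have hkk_mono : Monotone (kk k0 lam) := fun m n h =>
    mul_le_mul_of_nonneg_left (pow_le_pow_right₀ hlam.le h) hk0.le
  let A : ℕ → ℂ := fun n =>
    a * (kk k0 lam (n + 2) : ℝ) * conj (u (n + 2)) * v (n + 2 + 1) * conj (v (n + 1))
  let B : ℕ → ℂ := fun n =>
    b * (kk k0 lam (n + 1) : ℝ) * conj (sh u n) * v (n + 1 + 1) * conj (v (n + 1))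
  let C : ℕ → ℂ := fun n =>
    a * (kk k0 lam n : ℝ) * sh u n * sh v (n - 1) * conj (v (n + 1))
  let D : ℕ → ℂ := fun n =>
    b * (kk k0 lam n : ℝ) * sh u (n - 1) * sh v n * conj (v (n + 1))
  have hA : Summable fun n => ‖A n‖ := by
    refine summable_norm_trilinear hk0 hlam a 2 hM (fun n => ?_) (fun n => ?_) hv
    · simpa using huM (n + 1)
    · rw [abs_of_nonneg (hkk0 _)]
      exact hkk_mono (by omega)
  have hB : Summable fun n => ‖B n‖ := by
    refine summable_norm_trilinear hk0 hlam b 1 hM (fun n => ?_) (fun n => ?_) hv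
    · cases n with
      | zero => simpa [sh] using hM
      | succ n => simpa [sh] using huM n
    · rw [abs_of_nonneg (hkk0 _)]
      exact hkk_mono (by omega)
  obtain ⟨hC, hCA⟩ := summable_norm_and_tsum_eq_conj_of_delay (g := C) 2 hA
    (fun n hn => by interval_cases n <;> simp [C, sh])
    (fun n => by simp [A, C, sh, mul_right_comm])
  obtain ⟨hD, hDB⟩ := summable_norm_and_tsum_eq_conj_of_delay (g := D) 1 hB
    (fun n hn => by interval_cases n; simp [D, sh])
    (fun n => by simp [B, D, sh, mul_right_comm])
  have hterm : ∀ n, BSAB a b k0 lam u v (n + 1) * conj (v (n + 1)) =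
      Complex.I * (A n + B n + C n + D n) := fun n => by
    have h2 : n + 1 - 2 = n - 1 := by omega
    simp only [BSAB, bSAB, A, B, C, D, h2, Nat.add_sub_cancel]
    simp only [sh, Nat.add_eq_zero_iff, OfNat.ofNat_ne_zero, one_ne_zero, and_false, if_false]
    ring
  have hs := ((hA.of_norm.add hB.of_norm).add hC.of_norm).add hD.of_norm
  simp only [hterm]
  refine ⟨(hs.mul_left Complex.I).norm, ?_⟩
  rw [tsum_mul_left, ((hA.of_norm.add hB.of_norm).add hC.of_norm).tsum_add hD.of_norm,
    (hA.of_norm.add hB.of_norm).tsum_add hC.of_norm, hA.of_norm.tsum_add hB.of_norm, hCA, hDB]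
  simp
end

section
/- (Skew-symmetry of the GOY nonlinearity) For every u ∈ V_{1/2} and v, w ∈ V, the series defining (B(u,v), w)_V and (B(u,w), v)_V converge absolutely and Re (B(u,v), w)_V = − Re (B(u,w), v)_V. -/
open scoped ComplexConjugate

/-- A bounded sequence times two square-summable sequences is summable. -/
lemma summable_bounded_mul_conj_mul_conj {c x y : ℕ → ℂ} {M : ℝ} (hc : ∀ n, ‖c n‖ ≤ M)
    (hx : Summable fun n => ‖x n‖ ^ 2) (hy : Summable fun n => ‖y n‖ ^ 2) :
    Summable fun n => c n * conj (x n) * conj (y n) := by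
  refine Summable.of_norm_bounded ((hx.add hy).mul_left M) fun n => ?_
  have hM : 0 ≤ M := (norm_nonneg _).trans (hc n)
  rw [norm_mul, norm_mul, RCLike.norm_conj, RCLike.norm_conj, mul_assoc]
  refine mul_le_mul (hc n) ?_ (by positivity) hM
  nlinarith [sq_nonneg (‖x n‖ - ‖y n‖), sq_nonneg ‖x n‖, sq_nonneg ‖y n‖]

lemma exists_kk_mul_norm_le {k0 lam : ℝ} {u : ℕ → ℂ}
    (hu : Summable fun n : ℕ => (kk k0 lam (n + 1)) ^ 2 * ‖u (n + 1)‖ ^ 2) :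
    ∃ M : ℝ, ∀ n, ‖((kk k0 lam n : ℝ) : ℂ) * conj (sh u n)‖ ≤ M := by
  obtain ⟨C, hC⟩ := hu.tendsto_atTop_zero.bddAbove_range
  refine ⟨√C, fun n => Real.le_sqrt_of_sq_le ?_⟩
  have hC' : ∀ n, (kk k0 lam (n + 1)) ^ 2 * ‖u (n + 1)‖ ^ 2 ≤ C := fun n => hC ⟨n, rfl⟩
  rw [norm_mul, RCLike.norm_conj, Complex.norm_real, mul_pow, Real.norm_eq_abs, sq_abs]
  rcases n with _ | n
  · have : 0 ≤ C := le_trans (by positivity) (hC' 0)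
    simpa [sh] using this
  · simpa [sh] using hC' n

/-- Dropping finitely many leading zero terms does not change a sum. -/
lemma hasSum_of_hasSum_nat_add {f : ℕ → ℂ} {s : ℂ} {k : ℕ} (hf : ∀ n < k, f n = 0)
    (h : HasSum (fun n => f (n + k)) s) : HasSum f s := by
  have h' := (hasSum_nat_add_iff k).1 h
  rwa [Finset.sum_eq_zero fun n hn => hf n (Finset.mem_range.1 hn), add_zero] at h'

/-- The interaction term with coefficient `a`. -/
noncomputable def goyFar (a k0 lam : ℝ) (u v w : ℕ → ℂ) (n : ℕ) : ℂ :=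
  Complex.I * a * ((kk k0 lam (n + 2) : ℝ) * conj (sh u (n + 2))) *
    conj (v (n + 3)) * conj (w (n + 1))

/-- The interaction term with coefficient `b`. -/
noncomputable def goyNear (b k0 lam : ℝ) (u v w : ℕ → ℂ) (n : ℕ) : ℂ :=
  Complex.I * b * lam * ((kk k0 lam n : ℝ) * conj (sh u n)) *
    conj (v (n + 2)) * conj (w (n + 1))

section

variable {k0 lam : ℝ} {u v w : ℕ → ℂ}

lemma summable_goyFar (a : ℝ)
    (hu : Summable fun n : ℕ => (kk k0 lam (n + 1)) ^ 2 * ‖u (n + 1)‖ ^ 2)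
    (hv : Summable fun n : ℕ => ‖v (n + 1)‖ ^ 2) (hw : Summable fun n : ℕ => ‖w (n + 1)‖ ^ 2) :
    Summable (goyFar a k0 lam u v w) := by
  obtain ⟨M, hM⟩ := exists_kk_mul_norm_le hu
  refine summable_bounded_mul_conj_mul_conj (M := ‖Complex.I * a‖ * M) (fun n => ?_)
    ((summable_nat_add_iff 2).2 hv) hw
  rw [norm_mul]
  exact mul_le_mul_of_nonneg_left (hM _) (norm_nonneg _)

lemma summable_goyNear (b : ℝ)
    (hu : Summable fun n : ℕ => (kk k0 lam (n + 1)) ^ 2 * ‖u (n + 1)‖ ^ 2)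
    (hv : Summable fun n : ℕ => ‖v (n + 1)‖ ^ 2) (hw : Summable fun n : ℕ => ‖w (n + 1)‖ ^ 2) :
    Summable (goyNear b k0 lam u v w) := by
  obtain ⟨M, hM⟩ := exists_kk_mul_norm_le hu
  refine summable_bounded_mul_conj_mul_conj (M := ‖Complex.I * b * lam‖ * M) (fun n => ?_)
    ((summable_nat_add_iff 1).2 hv) hw
  rw [norm_mul]
  exact mul_le_mul_of_nonneg_left (hM _) (norm_nonneg _)

/-- The pairing `(B(u,v),w)` as an antisymmetrised sum of the two interaction terms. -/
lemma hasSum_BGOY_mul_conj (a b : ℝ)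
    (hu : Summable fun n : ℕ => (kk k0 lam (n + 1)) ^ 2 * ‖u (n + 1)‖ ^ 2)
    (hv : Summable fun n : ℕ => ‖v (n + 1)‖ ^ 2) (hw : Summable fun n : ℕ => ‖w (n + 1)‖ ^ 2) :
    HasSum (fun n : ℕ => BGOY a b k0 lam u v (n + 1) * conj (w (n + 1)))
      (∑' n, goyFar a k0 lam u w v n + ∑' n, goyNear b k0 lam u w v n
        - (∑' n, goyFar a k0 lam u v w n + ∑' n, goyNear b k0 lam u v w n)) := by
  have hfar : HasSum (fun n : ℕ => Complex.I * a * ((kk k0 lam n : ℝ) * conj (sh u n)) *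
      conj (sh v (n - 1)) * conj (w (n + 1))) (∑' n, goyFar a k0 lam u w v n) := by
    refine hasSum_of_hasSum_nat_add (k := 2) (fun n hn => ?_) ?_
    · interval_cases n <;> simp [sh]
    · convert (summable_goyFar a hu hw hv).hasSum using 1
      ext n
      simp only [goyFar, sh]
      simp
      ring
  have hnear : HasSum (fun n : ℕ => Complex.I * b * ((kk k0 lam n : ℝ) * conj (sh u (n - 1))) *
      conj (sh v n) * conj (w (n + 1))) (∑' n, goyNear b k0 lam u w v n) := by
    refine hasSum_of_hasSum_nat_add (k := 1) (fun n hn => ?_) ?_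
    · interval_cases n; simp [sh]
    · convert (summable_goyNear b hu hw hv).hasSum using 1
      ext n
      simp [goyNear, sh, kk]
      ring
  have hsum := (hfar.add hnear).sub
    ((summable_goyFar a hu hv hw).hasSum.add (summable_goyNear b hu hv hw).hasSum)
  refine (congrArg (HasSum · _) (funext fun n => ?_)).mpr hsum
  simp only [BGOY, bGOY, goyFar, goyNear, sh, kk, Nat.add_sub_cancel,
    show n + 1 - 2 = n - 1 by omega]
  simp
  ring

end

/-- Skew-symmetry of the GOY nonlinearity: for `u ∈ V_{1/2}` and `v, w ∈ V`, the series
defining `(B(u,v),w)_V` and `(B(u,w),v)_V` converge absolutely and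
`Re (B(u,v),w)_V = - Re (B(u,w),v)_V`. -/
theorem stmt4 (k0 lam a b : ℝ) (hk0 : 0 < k0) (hlam : 1 < lam)
    (u v w : ℕ → ℂ)
    (hu : Summable (fun n : ℕ => (kk k0 lam (n+1))^2 * ‖u (n+1)‖^2))
    (hv : Summable (fun n : ℕ => ‖v (n+1)‖^2))
    (hw : Summable (fun n : ℕ => ‖w (n+1)‖^2)) :
    Summable (fun n : ℕ => ‖BGOY a b k0 lam u v (n+1) * conj (w (n+1))‖) ∧
    Summable (fun n : ℕ => ‖BGOY a b k0 lam u w (n+1) * conj (v (n+1))‖) ∧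
    (∑' n : ℕ, BGOY a b k0 lam u v (n+1) * conj (w (n+1))).re
      = - (∑' n : ℕ, BGOY a b k0 lam u w (n+1) * conj (v (n+1))).re := by
  have hvw := hasSum_BGOY_mul_conj a b hu hv hw
  have hwv := hasSum_BGOY_mul_conj a b hu hw hv
  refine ⟨hvw.summable.norm, hwv.summable.norm, ?_⟩
  rw [hvw.tsum_eq, hwv.tsum_eq, ← Complex.neg_re, neg_sub]
end

section
/- (Bound (er) on the right-sided fractional derivative of a Hölder path) Let E be a Banach space, β′ ∈ (0,1], and α ∈ (1−β′, 1). There exists a constant c > 0, depending only on α and β′, such that for every function ω : [0,t] → E with finite Hölder seminorm |||ω|||_{β′} := sup_{0 ≤ p < q ≤ t} ‖ω(q)−ω(p)‖/(q−p)^{β′}, and every r ∈ [0,t): the Bochner integral ∫_r^t (ω(r) − ω(q))/(q−r)^{2−α} dq exists and ‖ (ω(r) − ω(t))/(t−r)^{1−α} + (1−α) ∫_r^t (ω(r) − ω(q))/(q−r)^{2−α} dq ‖ ≤ c |||ω|||_{β′} (t−r)^{α+β′−1}. -/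
open MeasureTheory Set

theorem continuousOn_of_norm_sub_le_mul_rpow {E : Type*} [NormedAddCommGroup E] {β L a b : ℝ}
    (hβ : 0 < β) {ω : ℝ → E}
    (h : ∀ p q : ℝ, a ≤ p → p < q → q ≤ b → ‖ω q - ω p‖ ≤ L * (q - p) ^ β) :
    ContinuousOn ω (Icc a b) := by
  intro x hx
  rw [ContinuousWithinAt, tendsto_iff_norm_sub_tendsto_zero]
  have hlim : Filter.Tendsto (fun y : ℝ => L * |y - x| ^ β) (nhdsWithin x (Icc a b)) (nhds 0) := by
    have hc : Continuous fun y : ℝ => L * |y - x| ^ β :=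
      continuous_const.mul ((continuous_id.sub continuous_const).abs.rpow_const
        fun _ => Or.inr hβ.le)
    simpa [Real.zero_rpow hβ.ne'] using (hc.tendsto x).mono_left nhdsWithin_le_nhds
  refine squeeze_zero' (Filter.Eventually.of_forall fun _ => norm_nonneg _) ?_ hlim
  filter_upwards [self_mem_nhdsWithin] with y hy
  rcases lt_trichotomy y x with hyx | rfl | hxy
  · rw [norm_sub_rev, abs_sub_comm, abs_of_pos (sub_pos.2 hyx)]
    exact h y x hy.1 hyx hx.2
  · simp [Real.zero_rpow hβ.ne']
  · rw [abs_of_pos (sub_pos.2 hxy)]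
    exact h x y hx.1 hxy hy.2

theorem integrableOn_Ioo_sub_rpow {s r t : ℝ} (hs : -1 < s) (hrt : r ≤ t) :
    IntegrableOn (fun q : ℝ => (q - r) ^ s) (Ioo r t) := by
  have h : IntervalIntegrable (fun x : ℝ => x ^ s) volume (r - r) (t - r) :=
    intervalIntegral.intervalIntegrable_rpow' hs
  rw [← intervalIntegrable_iff_integrableOn_Ioo_of_le hrt]
  simpa using h.comp_sub_right r

theorem setIntegral_Ioo_sub_rpow {s r t : ℝ} (hs : -1 < s) (hrt : r ≤ t) :
    ∫ q in Ioo r t, (q - r) ^ s = (t - r) ^ (s + 1) / (s + 1) := by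
  rw [← integral_Ioc_eq_integral_Ioo, ← intervalIntegral.integral_of_le hrt,
    intervalIntegral.integral_comp_sub_right (fun x : ℝ => x ^ s) r, integral_rpow (Or.inl hs),
    sub_self, Real.zero_rpow (by linarith), sub_zero]

theorem norm_inv_rpow_smul_le {E : Type*} [NormedAddCommGroup E] [NormedSpace ℝ E]
    {x a β L : ℝ} (hx : 0 < x) {v : E} (hv : ‖v‖ ≤ L * x ^ β) :
    ‖(x ^ a)⁻¹ • v‖ ≤ L * x ^ (β - a) := by
  have hxa : 0 < x ^ a := Real.rpow_pos_of_pos hx a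
  rw [norm_smul, Real.norm_of_nonneg (inv_nonneg.2 hxa.le), Real.rpow_sub hx]
  calc (x ^ a)⁻¹ * ‖v‖ ≤ (x ^ a)⁻¹ * (L * x ^ β) := by gcongr
    _ = L * (x ^ β / x ^ a) := by ring

/-- Bound (er) on the right-sided Weyl–Marchaud fractional derivative of a Hölder path:
for `β' ∈ (0,1]` and `α ∈ (1-β', 1)` there is a constant `c > 0`, depending only on `α`
and `β'`, such that for every Banach space `E`, every `ω : [0,t] → E` with
`β'`-Hölder seminorm at most `L`, and every `r ∈ [0,t)`, the defining Bochner integral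
exists and `‖D^{1-α}_{t-}ω_{t-}[r]‖ ≤ c L (t-r)^{α+β'-1}` (up to the constant factor
`(-1)^{1-α}/Γ(α)`). -/
theorem stmt14 (α β' : ℝ) (hβ'0 : 0 < β') (hβ'1 : β' ≤ 1)
    (hα0 : 1 - β' < α) (hα1 : α < 1) :
    ∃ c : ℝ, 0 < c ∧
      ∀ (E : Type) [NormedAddCommGroup E] [NormedSpace ℝ E] [CompleteSpace E],
      ∀ (t : ℝ) (ω : ℝ → E) (L : ℝ),
        (∀ p q : ℝ, 0 ≤ p → p < q → q ≤ t → ‖ω q - ω p‖ ≤ L * (q - p) ^ β') →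
        ∀ r : ℝ, 0 ≤ r → r < t →
          IntegrableOn (fun q : ℝ => ((q - r) ^ (2 - α))⁻¹ • (ω r - ω q)) (Ioo r t) ∧
          ‖((t - r) ^ (1 - α))⁻¹ • (ω r - ω t)
              + (1 - α) • ∫ q in Ioo r t, ((q - r) ^ (2 - α))⁻¹ • (ω r - ω q)‖
            ≤ c * L * (t - r) ^ (α + β' - 1) := by
  have hs : 0 < α + β' - 1 := by linarith
  refine ⟨1 + (1 - α) / (α + β' - 1),
    add_pos_of_pos_of_nonneg one_pos (div_nonneg (by linarith) hs.le), ?_⟩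
  intro E _ _ _ t ω L hω r hr hrt
  have hbound : ∀ q ∈ Ioo r t,
      ‖((q - r) ^ (2 - α))⁻¹ • (ω r - ω q)‖ ≤ L * (q - r) ^ (β' - (2 - α)) := fun q hq =>
    norm_inv_rpow_smul_le (sub_pos.2 hq.1) (by
      rw [norm_sub_rev]
      exact hω r q hr hq.1 hq.2.le)
  have hexp : -1 < β' - (2 - α) := by linarith
  have hdom : IntegrableOn (fun q : ℝ => L * (q - r) ^ (β' - (2 - α))) (Ioo r t) :=
    (integrableOn_Ioo_sub_rpow hexp hrt.le).const_mul L
  have hcont : ContinuousOn (fun q : ℝ => ((q - r) ^ (2 - α))⁻¹ • (ω r - ω q)) (Ioo r t) := by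
    refine ContinuousOn.smul (ContinuousOn.inv₀ ?_ ?_) (continuousOn_const.sub
      ((continuousOn_of_norm_sub_le_mul_rpow hβ'0 hω).mono
        fun q hq => ⟨hr.trans hq.1.le, hq.2.le⟩))
    · exact (continuousOn_id.sub continuousOn_const).rpow_const fun q hq =>
        Or.inl (sub_pos.2 hq.1).ne'
    · exact fun q hq => (Real.rpow_pos_of_pos (sub_pos.2 hq.1) _).ne'
  have hae := (ae_restrict_mem (μ := volume) (measurableSet_Ioo (a := r) (b := t))).mono hbound
  refine ⟨Integrable.mono' hdom (hcont.aestronglyMeasurable measurableSet_Ioo) hae, ?_⟩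
  have hint : ‖∫ q in Ioo r t, ((q - r) ^ (2 - α))⁻¹ • (ω r - ω q)‖
      ≤ L * ((t - r) ^ (α + β' - 1) / (α + β' - 1)) := by
    refine (norm_integral_le_of_norm_le hdom hae).trans_eq ?_
    rw [integral_const_mul, setIntegral_Ioo_sub_rpow hexp hrt.le,
      show β' - (2 - α) + 1 = α + β' - 1 by ring]
  have hbdry : ‖((t - r) ^ (1 - α))⁻¹ • (ω r - ω t)‖ ≤ L * (t - r) ^ (α + β' - 1) := by
    rw [show α + β' - 1 = β' - (1 - α) by ring]
    refine norm_inv_rpow_smul_le (sub_pos.2 hrt) ?_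
    rw [norm_sub_rev]
    exact hω r t hr hrt le_rfl
  have h1α : 0 ≤ 1 - α := by linarith
  calc _ ≤ L * (t - r) ^ (α + β' - 1)
        + (1 - α) * (L * ((t - r) ^ (α + β' - 1) / (α + β' - 1))) := by
        refine norm_add_le_of_le hbdry ?_
        rw [norm_smul, Real.norm_of_nonneg h1α]
        exact mul_le_mul_of_nonneg_left hint h1α
    _ = _ := by ring
end

section
/- (Lemma 8.2: continuity of the Hölder seminorm in its right endpoint) Let E be a normed space, 0 < β̂ < β̃ ≤ 1, s < T, and let u : [s,T] → E satisfy |||u|||_{β̃,[s,T]} := sup_{s ≤ p < q ≤ T} ‖u(q)−u(p)‖/(q−p)^{β̃} < ∞. Define φ(t) := |||u|||_{β̂,[s,t]} = sup_{s ≤ p < q ≤ t} ‖u(q)−u(p)‖/(q−p)^{β̂} for t ∈ (s,T] and φ(s) := 0. Then φ is continuous on [s,T]; in particular lim_{t→s+} |||u|||_{β̂,[s,t]} = 0. -/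
open Set Filter

/-- The `β`-Hölder difference quotients of `u` on `[s, t]`. -/
def holderQuotients {E : Type*} [NormedAddCommGroup E] (u : ℝ → E) (β s t : ℝ) : Set ℝ :=
  {x : ℝ | ∃ p q : ℝ, s ≤ p ∧ p < q ∧ q ≤ t ∧ x = ‖u q - u p‖ / (q - p) ^ β}

section HolderQuotients

variable {E : Type*} [NormedAddCommGroup E] {u : ℝ → E} {β γ s t T L : ℝ}

theorem holderQuotients_mono {a b : ℝ} (hab : a ≤ b) :
    holderQuotients u β s a ⊆ holderQuotients u β s b := by
  rintro x ⟨p, q, hp, hpq, hq, rfl⟩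
  exact ⟨p, q, hp, hpq, hq.trans hab, rfl⟩

theorem holderQuotients_self : holderQuotients u β s s = ∅ := by
  ext x
  simp only [holderQuotients, mem_ofPred_eq, mem_empty_iff_false, iff_false]
  rintro ⟨p, q, hp, hpq, hq, -⟩
  linarith

theorem sSup_holderQuotients_nonneg : 0 ≤ sSup (holderQuotients u β s t) := by
  refine Real.sSup_nonneg ?_
  rintro x ⟨p, q, -, hpq, -, rfl⟩
  have := sub_pos.2 hpq
  positivity

theorem holder_const_nonneg (hsT : s < T)
    (hu : ∀ p q : ℝ, s ≤ p → p < q → q ≤ T → ‖u q - u p‖ ≤ L * (q - p) ^ γ) : 0 ≤ L :=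
  nonneg_of_mul_nonneg_left ((norm_nonneg _).trans (hu s T le_rfl hsT le_rfl))
    (Real.rpow_pos_of_pos (sub_pos.2 hsT) γ)

theorem holderQuotient_le
    (hu : ∀ p q : ℝ, s ≤ p → p < q → q ≤ T → ‖u q - u p‖ ≤ L * (q - p) ^ γ)
    {p q : ℝ} (hp : s ≤ p) (hpq : p < q) (hq : q ≤ T) :
    ‖u q - u p‖ / (q - p) ^ β ≤ L * (q - p) ^ (γ - β) := by
  have hpos : 0 < q - p := sub_pos.2 hpq
  rw [Real.rpow_sub hpos, ← mul_div_assoc]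
  gcongr
  exact hu p q hp hpq hq

theorem bddAbove_holderQuotients (hβγ : β ≤ γ) (hsT : s < T) (htT : t ≤ T)
    (hu : ∀ p q : ℝ, s ≤ p → p < q → q ≤ T → ‖u q - u p‖ ≤ L * (q - p) ^ γ) :
    BddAbove (holderQuotients u β s t) := by
  have hL := holder_const_nonneg hsT hu
  refine ⟨L * (T - s) ^ (γ - β), ?_⟩
  rintro x ⟨p, q, hp, hpq, hq, rfl⟩
  have hpos : 0 ≤ q - p := (sub_pos.2 hpq).le
  refine (holderQuotient_le hu hp hpq (hq.trans htT)).trans ?_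
  gcongr
  linarith

/-- The `β`-Hölder seminorm of a `γ`-Hölder function is `(γ - β)`-Hölder in its right endpoint. -/
theorem sSup_holderQuotients_le_add (hβ : 0 ≤ β) (hβγ : β ≤ γ) (hsT : s < T)
    (hu : ∀ p q : ℝ, s ≤ p → p < q → q ≤ T → ‖u q - u p‖ ≤ L * (q - p) ^ γ)
    {a b : ℝ} (ha : s ≤ a) (hab : a ≤ b) (hb : b ≤ T) :
    sSup (holderQuotients u β s b) ≤ sSup (holderQuotients u β s a) + L * (b - a) ^ (γ - β) := by
  have hL := holder_const_nonneg hsT hu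
  have hφ : 0 ≤ sSup (holderQuotients u β s a) := sSup_holderQuotients_nonneg
  have hab' : 0 ≤ b - a := sub_nonneg.2 hab
  have hbdd := bddAbove_holderQuotients hβγ hsT (hab.trans hb) hu
  have short {p q : ℝ} (hap : a ≤ p) (hpq : p < q) (hq : q ≤ b) :
      ‖u q - u p‖ / (q - p) ^ β ≤ L * (b - a) ^ (γ - β) := by
    have hpos : 0 ≤ q - p := (sub_pos.2 hpq).le
    refine (holderQuotient_le hu (ha.trans hap) hpq (hq.trans hb)).trans ?_
    gcongr
  refine Real.sSup_le ?_ (by positivity)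
  rintro x ⟨p, q, hp, hpq, hq, rfl⟩
  rcases le_or_gt q a with hqa | hqa
  · have := le_csSup hbdd ⟨p, q, hp, hpq, hqa, rfl⟩
    have : 0 ≤ L * (b - a) ^ (γ - β) := by positivity
    linarith
  rcases le_or_gt a p with hap | hap
  · linarith [short hap hpq hq]
  have hqp : 0 < q - p := sub_pos.2 hpq
  have hpa : 0 < a - p := sub_pos.2 hap
  have haq : 0 < q - a := sub_pos.2 hqa
  have left : ‖u a - u p‖ / (q - p) ^ β ≤ sSup (holderQuotients u β s a) :=
    calc ‖u a - u p‖ / (q - p) ^ β ≤ ‖u a - u p‖ / (a - p) ^ β := by gcongr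
      _ ≤ _ := le_csSup hbdd ⟨p, a, hp, hap, le_rfl, rfl⟩
  have right : ‖u q - u a‖ / (q - p) ^ β ≤ L * (b - a) ^ (γ - β) :=
    calc ‖u q - u a‖ / (q - p) ^ β ≤ ‖u q - u a‖ / (q - a) ^ β := by gcongr
      _ ≤ _ := short le_rfl hqa hq
  calc ‖u q - u p‖ / (q - p) ^ β
      ≤ (‖u a - u p‖ + ‖u q - u a‖) / (q - p) ^ β := by
        gcongr
        rw [add_comm]
        exact norm_sub_le_norm_sub_add_norm_sub _ _ _
    _ = ‖u a - u p‖ / (q - p) ^ β + ‖u q - u a‖ / (q - p) ^ β := add_div _ _ _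
    _ ≤ _ := add_le_add left right

theorem continuousOn_sSup_holderQuotients (hβ : 0 ≤ β) (hβγ : β < γ) (hsT : s < T)
    (hu : ∀ p q : ℝ, s ≤ p → p < q → q ≤ T → ‖u q - u p‖ ≤ L * (q - p) ^ γ) :
    ContinuousOn (fun t => sSup (holderQuotients u β s t)) (Icc s T) := by
  have of_le {a b : ℝ} (ha : s ≤ a) (hab : a ≤ b) (hb : b ≤ T) :
      dist (sSup (holderQuotients u β s b)) (sSup (holderQuotients u β s a)) ≤
        L * |b - a| ^ (γ - β) := by
    have hmono : sSup (holderQuotients u β s a) ≤ sSup (holderQuotients u β s b) := by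
      refine Real.sSup_le (fun x hx => ?_) sSup_holderQuotients_nonneg
      exact le_csSup (bddAbove_holderQuotients hβγ.le hsT hb hu) (holderQuotients_mono hab hx)
    rw [Real.dist_eq, abs_of_nonneg (sub_nonneg.2 hmono), abs_of_nonneg (sub_nonneg.2 hab),
      sub_le_iff_le_add']
    exact sSup_holderQuotients_le_add hβ hβγ.le hsT hu ha hab hb
  intro a ha
  refine tendsto_iff_dist_tendsto_zero.2 ?_
  have hlim : Tendsto (fun b : ℝ => L * |b - a| ^ (γ - β)) (nhdsWithin a (Icc s T)) (nhds 0) := by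
    have hcont : Continuous fun b : ℝ => L * |b - a| ^ (γ - β) :=
      continuous_const.mul
        ((continuous_id.sub continuous_const).abs.rpow_const fun _ => Or.inr (sub_pos.2 hβγ).le)
    have := (hcont.tendsto a).mono_left (nhdsWithin_le_nhds (s := Icc s T))
    simpa [Real.zero_rpow (sub_pos.2 hβγ).ne'] using this
  refine squeeze_zero' (Eventually.of_forall fun _ => dist_nonneg) ?_ hlim
  filter_upwards [self_mem_nhdsWithin] with b hb
  rcases le_total a b with hab | hba
  · exact of_le ha.1 hab hb.2
  · rw [dist_comm, abs_sub_comm]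
    exact of_le hb.1 hba ha.2

end HolderQuotients

/-- Lemma 8.2: continuity of the Hölder seminorm in its right endpoint.  If
`u : [s,T] → E` is `β̃`-Hölder (with constant `L`) and `0 < β̂ < β̃ ≤ 1`, then
`t ↦ |||u|||_{β̂,[s,t]} = sup_{s ≤ p < q ≤ t} ‖u(q)-u(p)‖/(q-p)^β̂` is continuous on
`[s,T]` (with value `0 = sSup ∅` at `t = s`), and in particular it tends to `0` as
`t → s⁺`. -/
theorem stmt18 (E : Type*) [NormedAddCommGroup E] (βh βt : ℝ)
    (h1 : 0 < βh) (h2 : βh < βt) (h3 : βt ≤ 1) (s T : ℝ) (hsT : s < T)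
    (u : ℝ → E) (L : ℝ)
    (hu : ∀ p q : ℝ, s ≤ p → p < q → q ≤ T → ‖u q - u p‖ ≤ L * (q - p) ^ βt) :
    ContinuousOn
      (fun t : ℝ => sSup {x : ℝ | ∃ p q : ℝ,
        s ≤ p ∧ p < q ∧ q ≤ t ∧ x = ‖u q - u p‖ / (q - p) ^ βh}) (Icc s T) ∧
    Tendsto
      (fun t : ℝ => sSup {x : ℝ | ∃ p q : ℝ,
        s ≤ p ∧ p < q ∧ q ≤ t ∧ x = ‖u q - u p‖ / (q - p) ^ βh})
      (nhdsWithin s (Ioi s)) (nhds 0) := by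
  have hcont := continuousOn_sSup_holderQuotients h1.le h2 hsT hu
  refine ⟨hcont, ?_⟩
  have hlim := hcont s (left_mem_Icc.2 hsT.le)
  rw [ContinuousWithinAt, holderQuotients_self, Real.sSup_empty] at hlim
  rw [← nhdsWithin_Ioc_eq_nhdsGT hsT]
  exact hlim.mono_left (nhdsWithin_mono s Ioc_subset_Icc_self)
end
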